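/- For every ε > 0 and δ > 0 there exists q_0 such that for every prime power q ≥ q_0 and every real p with (log q)³/√q ≤ p ≤ 1, the probability that the p-random set S_p ⊆ 𝔽_q² contains a collinear-triple-free subset of size at least (1+ε)·p·q is at most δ. In other words, with high probability α(𝔽_q²,p) ≤ (1+o(1))·p·q whenever p ≥ (log q)³/√q. -/

import Mathlib

open MeasureTheory NNReal

/-- **Kleitman–Winston graph containers.** -/
theorem exists_container {V : Type*} [DecidableEq V] (r : V → V → Prop) [DecidableRel r]
    (W : Finset V) {β R : ℝ} (hr : ∀ U ⊆ W, R < U.card →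
      ∃ v ∈ U, ¬ r v v ∧ β * U.card ≤ (U.filter (r v)).card)
    (U : Finset V) (hU : U ⊆ W) :
    ∃ C : Finset V → Finset V, (∀ T, ((C T).card : ℝ) ≤ R) ∧
      ∀ I ⊆ U, (∀ x ∈ I, ∀ y ∈ I, ¬ r x y) →
        ∃ T ⊆ I, I ⊆ T ∪ C T ∧ (T = ∅ ∨ R * Real.exp (β * (T.card - 1)) ≤ U.card) := by
  induction U using Finset.strongInduction with
  | H U ih =>
    by_cases hRU : (U.card : ℝ) ≤ R
    · exact ⟨fun _ => U, fun _ => hRU, fun I hI _ => ⟨∅, by simp, by simpa using hI, Or.inl rfl⟩⟩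
    push Not at hRU
    obtain ⟨v, hv, hvv, hdeg⟩ := hr U hU hRU
    have hs₁ : U.erase v ⊂ U := Finset.erase_ssubset hv
    have hs₂ : (U.erase v).filter (fun y => ¬ r v y) ⊂ U :=
      (Finset.filter_subset _ _).trans_ssubset hs₁
    obtain ⟨C₁, hC₁, h₁⟩ := ih _ hs₁ (hs₁.subset.trans hU)
    obtain ⟨C₂, hC₂, h₂⟩ := ih _ hs₂ (hs₂.subset.trans hU)
    refine ⟨fun T => if v ∈ T then C₂ (T.erase v) else C₁ T, fun T => ?_, fun I hI hind => ?_⟩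
    · dsimp only
      split_ifs
      exacts [hC₂ _, hC₁ _]
    by_cases hvI : v ∈ I
    · obtain ⟨T, hT, hIT, hcard⟩ := h₂ (I.erase v) (fun x hx => by
        have hx' := Finset.mem_erase.1 hx
        simp [hx'.1, hI hx'.2, hind v hvI x hx'.2])
        (fun x hx y hy => hind x (Finset.mem_of_mem_erase hx) y (Finset.mem_of_mem_erase hy))
      have hvT : v ∉ T := fun h => Finset.notMem_erase v I (hT h)
      refine ⟨insert v T, Finset.insert_subset hvI (hT.trans (Finset.erase_subset _ _)), ?_,
        Or.inr ?_⟩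
      · intro x hx
        by_cases hxv : x = v
        · simp [hxv]
        have := hIT (Finset.mem_erase.2 ⟨hxv, hx⟩)
        simpa [hxv, hvT] using this
      · rw [Finset.card_insert_of_notMem hvT]
        push_cast
        rw [add_sub_cancel_right]
        rcases hcard with rfl | hcard
        · simpa using hRU.le
        have hle : (((U.erase v).filter (fun y => ¬ r v y)).card : ℝ) ≤ (1 - β) * U.card := by
          have h1 : ((U.erase v).filter (fun y => ¬ r v y)).card ≤
              (U.filter (fun y => ¬ r v y)).card :=
            Finset.card_le_card (Finset.filter_subset_filter _ (Finset.erase_subset _ _))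
          have h2 := Finset.card_filter_add_card_filter_not (s := U) (r v)
          have h1' : (((U.erase v).filter (fun y => ¬ r v y)).card : ℝ) ≤
              (U.filter (fun y => ¬ r v y)).card := by exact_mod_cast h1
          have h2' : ((U.filter (r v)).card : ℝ) + (U.filter (fun y => ¬ r v y)).card = U.card := by
            exact_mod_cast h2
          linarith
        calc R * Real.exp (β * T.card)
            = R * Real.exp (β * (T.card - 1)) * Real.exp β := by
              rw [mul_assoc, ← Real.exp_add]; ring_nf
          _ ≤ (1 - β) * U.card * Real.exp β :=
              mul_le_mul_of_nonneg_right (hcard.trans hle) (Real.exp_pos _).le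
          _ ≤ Real.exp (-β) * U.card * Real.exp β := by
              gcongr; exact Real.one_sub_le_exp_neg β
          _ = U.card := by rw [mul_right_comm, ← Real.exp_add]; simp
    · obtain ⟨T, hT, hIT, hcard⟩ := h₁ I (Finset.subset_erase.2 ⟨hI, hvI⟩) hind
      have hvT : v ∉ T := fun h => hvI (hT h)
      refine ⟨T, hT, by simpa [hvT] using hIT, hcard.imp_right fun h => h.trans ?_⟩
      exact_mod_cast Finset.card_le_card hs₁.subset

section Plane

variable {F : Type*} [Field F]

/-- The slope of a vector of the plane, `none` standing for vertical vectors. -/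
noncomputable def slopeOption (v : Fin 2 → F) : Option F :=
  open Classical in if v 0 = 0 then none else some (v 1 / v 0)

theorem collinear_of_slopeOption_eq {f x y : Fin 2 → F} (hx : x ≠ f)
    (h : slopeOption (x - f) = slopeOption (y - f)) : Collinear F {f, x, y} := by
  rw [collinear_iff_of_mem (p₀ := f) (by simp)]
  refine ⟨x - f, ?_⟩
  have hy : ∃ r : F, y = r • (x - f) +ᵥ f := by
    unfold slopeOption at h
    by_cases h0 : (x - f) 0 = 0
    · have h0y : (y - f) 0 = 0 := by
        by_contra hne
        rw [if_pos h0, if_neg hne] at h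
        exact Option.some_ne_none _ h.symm
      have h1 : (x - f) 1 ≠ 0 := by
        intro h1
        apply hx
        ext i
        fin_cases i
        · simpa [sub_eq_zero] using h0
        · simpa [sub_eq_zero] using h1
      refine ⟨(y - f) 1 / (x - f) 1, ?_⟩
      ext i
      fin_cases i
      · simp only [Pi.sub_apply] at h0 h0y
        simpa [h0, sub_eq_zero] using h0y
      · simp only [Pi.sub_apply] at h1
        simp [h1]
    · have h0y : (y - f) 0 ≠ 0 := by
        intro h0y
        rw [if_neg h0, if_pos h0y] at h
        exact Option.some_ne_none _ h
      simp only [h0, h0y, if_false, Option.some.injEq] at h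
      refine ⟨(y - f) 0 / (x - f) 0, ?_⟩
      simp only [Pi.sub_apply] at h h0 h0y
      ext i
      fin_cases i
      · simp [h0]
      · simp only [Pi.sub_apply, Pi.smul_apply, vadd_eq_add, Pi.add_apply, smul_eq_mul]
        show y 1 = _ * (x 1 - f 1) + f 1
        field_simp at h ⊢
        linear_combination -h
  intro z hz
  rcases hz with rfl | rfl | rfl
  · exact ⟨0, by simp⟩
  · exact ⟨1, by simp⟩
  · exact hy

/-- `A` contains no collinear triple. -/
def IsArc (A : Finset (Fin 2 → F)) : Prop :=
  ∀ t : Finset (Fin 2 → F), t ⊆ A → t.card = 3 → ¬ Collinear F (t : Set (Fin 2 → F))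

theorem IsArc.mono {A B : Finset (Fin 2 → F)} (hA : IsArc A) (h : B ⊆ A) : IsArc B :=
  fun t ht => hA t (ht.trans h)

open Classical in
theorem IsArc.not_collinear {A : Finset (Fin 2 → F)} (hA : IsArc A) {x y z : Fin 2 → F}
    (hx : x ∈ A) (hy : y ∈ A) (hz : z ∈ A) (hxy : x ≠ y) (hxz : x ≠ z) (hyz : y ≠ z) :
    ¬ Collinear F {x, y, z} := by
  have := hA {x, y, z} (by simp [Finset.insert_subset_iff, hx, hy, hz])
    (Finset.card_eq_three.2 ⟨x, y, z, hxy, hxz, hyz, rfl⟩)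
  simpa using this

open Classical in
theorem IsArc.card_filter_collinear_le {A : Finset (Fin 2 → F)} (hA : IsArc A) {x y : Fin 2 → F}
    (hxy : x ≠ y) : (A.filter fun f => Collinear F {f, x, y}).card ≤ 2 := by
  by_contra! h
  obtain ⟨a, b, c, ha, hb, hc, hab, hac, hbc⟩ := Finset.two_lt_card_iff.1 h
  rw [Finset.mem_filter] at ha hb hc
  have hline : ∀ f, Collinear F {f, x, y} → f ∈ line[F, x, y] := fun f hf =>
    hf.mem_affineSpan_of_mem_of_ne (by simp) (by simp) (by simp) hxy
  exact hA.not_collinear ha.1 hb.1 hc.1 hab hac hbc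
    (collinear_triple_of_mem_affineSpan_pair (hline a ha.2) (hline b hb.2) (hline c hc.2))

open Classical in
theorem sq_card_le_card_collinear_pairs [Fintype F] {f : Fin 2 → F} {U : Finset (Fin 2 → F)}
    (hf : f ∉ U) : U.card ^ 2 ≤ (Fintype.card F + 1) *
      ((U ×ˢ U).filter fun z => Collinear F {f, z.1, z.2}).card := by
  set u : Option F → ℕ := fun o => (U.filter fun x => slopeOption (x - f) = o).card
  have hsum : U.card = ∑ o, u o :=
    Finset.card_eq_sum_card_fiberwise (by simp [Set.MapsTo])
  have hsq : ∑ o, u o ^ 2 ≤ ((U ×ˢ U).filter fun z => Collinear F {f, z.1, z.2}).card := by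
    calc ∑ o, u o ^ 2
        = ((U ×ˢ U).filter fun z => slopeOption (z.1 - f) = slopeOption (z.2 - f)).card := by
          rw [Finset.card_eq_sum_card_fiberwise (f := fun z => slopeOption (z.1 - f))
            (t := Finset.univ) (by simp [Set.MapsTo])]
          refine Finset.sum_congr rfl fun o _ => ?_
          rw [sq, ← Finset.card_product]
          congr 1
          ext z
          simp only [Finset.mem_product, Finset.mem_filter]
          constructor
          · rintro ⟨⟨h1, h2⟩, h3, h4⟩
            exact ⟨⟨⟨h1, h3⟩, h2.trans h4.symm⟩, h2⟩
          · rintro ⟨⟨⟨h1, h3⟩, h2⟩, h4⟩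
            exact ⟨⟨h1, h4⟩, h3, h2 ▸ h4⟩
      _ ≤ _ := by
          refine Finset.card_le_card fun z hz => ?_
          rw [Finset.mem_filter, Finset.mem_product] at hz ⊢
          exact ⟨hz.1, collinear_of_slopeOption_eq (fun h => hf (h ▸ hz.1.1)) hz.2⟩
  calc U.card ^ 2 ≤ (Fintype.card F + 1) * ∑ o, u o ^ 2 := by
        rw [hsum]
        simpa using sq_sum_le_card_mul_sum_sq (s := (Finset.univ : Finset (Option F))) (f := u)
    _ ≤ _ := by gcongr

/-- `x` and `y` are distinct and span a line meeting `A`. -/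
def JoinMeets (A : Finset (Fin 2 → F)) (x y : Fin 2 → F) : Prop :=
  x ≠ y ∧ ∃ f ∈ A, Collinear F {f, x, y}

open Classical in
theorem IsArc.card_mul_sq_card_le [Fintype F] {A : Finset (Fin 2 → F)} (hA : IsArc A)
    {U : Finset (Fin 2 → F)} (hAU : Disjoint A U) :
    A.card * U.card ^ 2 ≤ (Fintype.card F + 1) *
      (A.card * U.card + 2 * ∑ x ∈ U, (U.filter (JoinMeets A x)).card) := by
  have h1 : ∀ f ∈ A, ((U ×ˢ U).filter fun z => Collinear F {f, z.1, z.2}).card ≤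
      U.card + ((U ×ˢ U).filter fun z => z.1 ≠ z.2 ∧ Collinear F {f, z.1, z.2}).card := by
    intro f _
    rw [← Finset.card_filter_add_card_filter_not
      (p := fun z : (Fin 2 → F) × (Fin 2 → F) => z.1 = z.2)]
    gcongr
    · refine Finset.card_le_card_of_injOn Prod.fst (fun z hz => ?_) (fun z hz w hw h => ?_)
      · simp only [Finset.coe_filter, Finset.mem_filter, Finset.mem_product, Set.mem_ofPred_eq] at hz
        exact hz.1.1.1
      · simp only [Finset.coe_filter, Finset.mem_filter, Finset.mem_product, Set.mem_ofPred_eq]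
          at hz hw
        exact Prod.ext h (hz.2 ▸ hw.2 ▸ h)
    · intro z hz
      simp only [Finset.mem_filter] at hz ⊢
      exact ⟨hz.1.1, hz.2, hz.1.2⟩
  have h2 : ∑ f ∈ A, ((U ×ˢ U).filter fun z => z.1 ≠ z.2 ∧ Collinear F {f, z.1, z.2}).card ≤
      2 * ∑ x ∈ U, (U.filter (JoinMeets A x)).card := by
    simp_rw [Finset.card_filter]
    rw [Finset.sum_comm, Finset.sum_product, Finset.mul_sum]
    refine Finset.sum_le_sum fun x _ => ?_
    rw [Finset.mul_sum]
    refine Finset.sum_le_sum fun y _ => ?_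
    by_cases hxy : x = y
    · simp [hxy]
    by_cases hj : JoinMeets A x y
    · have := hA.card_filter_collinear_le hxy
      rw [Finset.card_filter] at this
      simpa [hxy, hj] using this
    · rw [Finset.sum_eq_zero]
      · simp
      · intro f hf
        rw [if_neg]
        exact fun h => hj ⟨h.1, f, hf, h.2⟩
  calc A.card * U.card ^ 2 = ∑ f ∈ A, U.card ^ 2 := by simp
    _ ≤ ∑ f ∈ A, (Fintype.card F + 1) * (U.card +
        ((U ×ˢ U).filter fun z => z.1 ≠ z.2 ∧ Collinear F {f, z.1, z.2}).card) := by
        refine Finset.sum_le_sum fun f hf => ?_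
        refine (sq_card_le_card_collinear_pairs (Finset.disjoint_left.1 hAU hf)).trans ?_
        gcongr
        exact h1 f hf
    _ = (Fintype.card F + 1) * (A.card * U.card + ∑ f ∈ A,
        ((U ×ˢ U).filter fun z => z.1 ≠ z.2 ∧ Collinear F {f, z.1, z.2}).card) := by
        rw [← Finset.mul_sum, Finset.sum_add_distrib]; simp
    _ ≤ _ := by gcongr

open Classical in
theorem IsArc.exists_le_degree [Fintype F] {A : Finset (Fin 2 → F)} (hA : IsArc A)
    {U : Finset (Fin 2 → F)} (hAU : Disjoint A U) {γ : ℝ} (hγ : 0 < γ)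
    (hU : (1 + γ) * (Fintype.card F + 1) < U.card) :
    ∃ v ∈ U, A.card * γ / (2 * (1 + γ) * (Fintype.card F + 1)) * U.card ≤
      (U.filter (JoinMeets A v)).card := by
  have hq : (0 : ℝ) < Fintype.card F + 1 := by positivity
  have key : (A.card : ℝ) * U.card ^ 2 ≤ (Fintype.card F + 1) *
      (A.card * U.card + 2 * ∑ x ∈ U, ((U.filter (JoinMeets A x)).card : ℝ)) := by
    exact_mod_cast hA.card_mul_sq_card_le hAU
  set Q : ℝ := Fintype.card F + 1
  have hU0 : (0 : ℝ) < U.card := lt_trans (by positivity) hU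
  have hne : U.Nonempty := Finset.card_pos.1 (by exact_mod_cast hU0)
  by_contra! h
  have hlt := Finset.sum_lt_sum_of_nonempty hne h
  rw [Finset.sum_const, nsmul_eq_mul] at hlt
  have h3 : (A.card : ℝ) * U.card ^ 2 < Q * (A.card * U.card +
      2 * (U.card * (A.card * γ / (2 * (1 + γ) * Q) * U.card))) :=
    key.trans_lt (by gcongr)
  have h4 : Q * (A.card * U.card +
      2 * (U.card * (A.card * γ / (2 * (1 + γ) * Q) * U.card))) =
      A.card * U.card * ((1 + γ) * Q + γ * U.card) / (1 + γ) := by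
    field_simp
  rw [h4, lt_div_iff₀ (by positivity)] at h3
  have : (A.card : ℝ) * U.card * ((1 + γ) * Q + γ * U.card) ≤
      A.card * U.card * (U.card + γ * U.card) := by gcongr
  nlinarith

/-- Every arc with at least `s` points consists of `s` points, few further points, and a subset of
a set of about `q` points determined by these. -/
theorem exists_arc_container (F : Type*) [Field F] [Fintype F] [DecidableEq F] (s : ℕ) {γ : ℝ}
    (hγ : 0 < γ) :
    ∃ C : Finset (Fin 2 → F) → Finset (Fin 2 → F) → Finset (Fin 2 → F),
      (∀ B T, ((C B T).card : ℝ) ≤ (1 + γ) * (Fintype.card F + 1)) ∧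
      ∀ A : Finset (Fin 2 → F), IsArc A → s ≤ A.card →
        ∃ B T : Finset (Fin 2 → F), B.card = s ∧ A ⊆ B ∪ T ∪ C B T ∧ (T = ∅ ∨
          Real.exp (s * γ / (2 * (1 + γ) * (Fintype.card F + 1)) * (T.card - 1)) ≤
            Fintype.card F) := by
  classical
  have hq : (1 : ℝ) ≤ Fintype.card F := by exact_mod_cast Fintype.card_pos
  have hB : ∀ B : Finset (Fin 2 → F), ∃ C : Finset (Fin 2 → F) → Finset (Fin 2 → F),
      (∀ T, ((C T).card : ℝ) ≤ (1 + γ) * (Fintype.card F + 1)) ∧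
      (IsArc B → ∀ I : Finset (Fin 2 → F), Disjoint B I →
        (∀ x ∈ I, ∀ y ∈ I, ¬ JoinMeets B x y) → ∃ T ⊆ I, I ⊆ T ∪ C T ∧ (T = ∅ ∨
          (1 + γ) * (Fintype.card F + 1) *
            Real.exp (B.card * γ / (2 * (1 + γ) * (Fintype.card F + 1)) * (T.card - 1)) ≤
            (Finset.univ \ B).card)) := by
    intro B
    by_cases hB : IsArc B
    · obtain ⟨C, hC, h⟩ := exists_container (JoinMeets B) (Finset.univ \ B) (fun U hU hlt => by
        obtain ⟨v, hv, h⟩ := hB.exists_le_degree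
          (Finset.disjoint_of_subset_right hU Finset.disjoint_sdiff) hγ hlt
        exact ⟨v, hv, fun h => h.1 rfl, h⟩) _ subset_rfl
      refine ⟨C, hC, fun _ I hI hind => h I (fun x hx => ?_) hind⟩
      simpa using Finset.disjoint_right.1 hI hx
    · exact ⟨fun _ => ∅, fun _ => by simp; positivity, fun h => absurd h hB⟩
  choose C hC h using hB
  refine ⟨C, hC, fun A hA hs => ?_⟩
  obtain ⟨B, hBA, rfl⟩ := Finset.exists_subset_card_eq hs
  obtain ⟨T, -, hT, hcard⟩ := h B (hA.mono hBA) (A \ B) Finset.disjoint_sdiff (by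
    rintro x hx y hy ⟨hxy, f, hf, hcol⟩
    rw [Finset.mem_sdiff] at hx hy
    exact hA.not_collinear (hBA hf) hx.1 hy.1 (by rintro rfl; exact hx.2 hf)
      (by rintro rfl; exact hy.2 hf) hxy hcol)
  refine ⟨B, T, rfl, fun x hx => ?_, hcard.imp_right fun h => ?_⟩
  · by_cases hxB : x ∈ B
    · simp [hxB]
    · have := hT (Finset.mem_sdiff.2 ⟨hx, hxB⟩)
      rw [Finset.union_assoc]
      exact Finset.mem_union_right _ this
  · have hle : ((Finset.univ \ B).card : ℝ) ≤ Fintype.card F ^ 2 := by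
      have := Finset.card_le_univ (Finset.univ \ B)
      rw [Fintype.card_fun, Fintype.card_fin] at this
      exact_mod_cast this
    refine le_of_mul_le_mul_left (a := (Fintype.card F : ℝ)) ?_ (by positivity)
    rw [← sq]
    refine le_trans ?_ (h.trans hle)
    gcongr
    nlinarith

end Plane

set_option linter.deprecated false in
/-- **Chernoff bound**: the points of `C` retained with probability `p`. -/
theorem measureReal_pi_bernoulli_le {V : Type*} [Fintype V] (p : ℝ≥0) (hp : p ≤ 1) (C : Finset V)
    {l : ℝ} (hl : 0 ≤ l) (a : ℝ) :
    (Measure.pi fun _ : V => (PMF.bernoulli p hp).toMeasure).real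
      {ω : V → Bool | a ≤ ((C.filter fun x => ω x = true).card : ℝ)} ≤
      Real.exp (p * C.card * (Real.exp l - 1) - l * a) := by
  classical
  set μ := Measure.pi fun _ : V => (PMF.bernoulli p hp).toMeasure
  set g : V → Bool → ℝ := fun x b => if x ∈ C then cond b (Real.exp l) 1 else 1
  have hprod : ∀ ω : V → Bool,
      ∏ x, g x (ω x) = Real.exp (l * (C.filter fun x => ω x = true).card) := by
    intro ω
    rw [mul_comm, Real.exp_nat_mul, ← Finset.prod_const, Finset.prod_filter,
      ← Finset.prod_filter_mul_prod_filter_not Finset.univ (· ∈ C)]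
    rw [Finset.prod_eq_one (s := Finset.univ.filter (· ∉ C))]
    · rw [mul_one, Finset.filter_univ_mem]
      refine Finset.prod_congr rfl fun x hx => ?_
      cases h : ω x <;> simp [g, hx]
    · intro x hx
      simp [g, (Finset.mem_filter.1 hx).2]
  have hint : ∫ ω, ∏ x, g x (ω x) ∂μ ≤ Real.exp (p * C.card * (Real.exp l - 1)) := by
    rw [integral_fintype_prod_eq_prod]
    calc ∏ x, ∫ b, g x b ∂(PMF.bernoulli p hp).toMeasure
        ≤ ∏ x, if x ∈ C then Real.exp (p * (Real.exp l - 1)) else 1 := by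
          refine Finset.prod_le_prod (fun x _ => integral_nonneg fun b => ?_) fun x _ => ?_
          · cases b <;> simp only [g] <;> split_ifs <;> simp [Real.exp_nonneg]
          · rw [PMF.integral_eq_sum]
            have hsub : ((1 - p : ℝ≥0) : ℝ) = 1 - p := NNReal.coe_sub hp
            by_cases hx : x ∈ C
            · simp only [Fintype.sum_bool, PMF.bernoulli_apply, g, hx, if_true, cond_true,
                cond_false, ENNReal.coe_toReal, smul_eq_mul, hsub]
              have := Real.add_one_le_exp (p * (Real.exp l - 1))
              linarith
            · simp [PMF.bernoulli_apply, g, hx, hsub]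
      _ = Real.exp (p * C.card * (Real.exp l - 1)) := by
          rw [Finset.prod_ite_mem, Finset.univ_inter, Finset.prod_const, ← Real.exp_nat_mul]
          ring_nf
  have hmarkov := mul_meas_ge_le_integral_of_nonneg (μ := μ) (f := fun ω => ∏ x, g x (ω x))
    (Filter.Eventually.of_forall fun ω => by
      change 0 ≤ ∏ x, g x (ω x)
      rw [hprod]; exact (Real.exp_pos _).le) .of_finite
    (Real.exp (l * a))
  have hsub : {ω : V → Bool | a ≤ ((C.filter fun x => ω x = true).card : ℝ)} ⊆
      {ω | Real.exp (l * a) ≤ ∏ x, g x (ω x)} := by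
    intro ω hω
    rw [Set.mem_ofPred_eq] at hω ⊢
    rw [hprod]
    gcongr
  have := (mul_le_mul_of_nonneg_left (measureReal_mono (μ := μ) hsub)
    (Real.exp_pos (l * a)).le).trans (hmarkov.trans hint)
  rw [Real.exp_sub, le_div_iff₀' (Real.exp_pos _)]
  exact this

theorem card_filter_card_le_le {V : Type*} [Fintype V] [Nonempty V] (k : ℕ) :
    ((Finset.univ : Finset (Finset V)).filter fun T => T.card ≤ k).card ≤
      (k + 1) * Fintype.card V ^ k := by
  classical
  have : ((Finset.univ : Finset (Finset V)).filter fun T => T.card ≤ k) ⊆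
      (Finset.range (k + 1)).biUnion fun j => Finset.univ.powersetCard j := by
    intro T hT
    simpa [Nat.lt_succ_iff] using hT
  refine (Finset.card_le_card this).trans (Finset.card_biUnion_le.trans ?_)
  calc ∑ j ∈ Finset.range (k + 1), (Finset.powersetCard j (Finset.univ : Finset V)).card
      ≤ ∑ j ∈ Finset.range (k + 1), Fintype.card V ^ k := by
        refine Finset.sum_le_sum fun j hj => ?_
        rw [Finset.card_powersetCard, Finset.card_univ]
        exact (Nat.choose_le_pow _ _).trans
          (Nat.pow_le_pow_right Fintype.card_pos (Nat.lt_succ_iff.1 (Finset.mem_range.1 hj)))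
    _ = _ := by simp

set_option linter.deprecated false in
/-- Union bound over the pairs of an `s`-set and a set of size at most `k`. -/
theorem measureReal_pi_bernoulli_exists_le {V : Type*} [Fintype V] [Nonempty V] (p : ℝ≥0)
    (hp : p ≤ 1) (C : Finset V → Finset V → Finset V) (s k : ℕ) {R l a : ℝ}
    (hC : ∀ B T, ((C B T).card : ℝ) ≤ R) (hl : 0 ≤ l) :
    (Measure.pi fun _ : V => (PMF.bernoulli p hp).toMeasure).real
      {ω : V → Bool | ∃ B T : Finset V, B.card = s ∧ T.card ≤ k ∧
        a ≤ (((C B T).filter fun x => ω x = true).card : ℝ)} ≤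
      (Fintype.card V : ℝ) ^ s * ((k + 1) * (Fintype.card V : ℝ) ^ k) *
        Real.exp (p * R * (Real.exp l - 1) - l * a) := by
  classical
  set P := (Finset.univ : Finset V).powersetCard s ×ˢ
    ((Finset.univ : Finset (Finset V)).filter fun T => T.card ≤ k)
  have hsub : {ω : V → Bool | ∃ B T : Finset V, B.card = s ∧ T.card ≤ k ∧
        a ≤ (((C B T).filter fun x => ω x = true).card : ℝ)} ⊆
      ⋃ z ∈ P, {ω | a ≤ (((C z.1 z.2).filter fun x => ω x = true).card : ℝ)} := by
    rintro ω ⟨B, T, hB, hT, h⟩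
    simp only [Set.mem_iUnion]
    exact ⟨(B, T), by simp [P, hB, hT], h⟩
  have hP : (P.card : ℝ) ≤ (Fintype.card V : ℝ) ^ s * ((k + 1) * (Fintype.card V : ℝ) ^ k) := by
    have : P.card ≤ Fintype.card V ^ s * ((k + 1) * Fintype.card V ^ k) := by
      rw [Finset.card_product, Finset.card_powersetCard, Finset.card_univ]
      exact Nat.mul_le_mul (Nat.choose_le_pow _ _) (card_filter_card_le_le k)
    exact_mod_cast this
  have h1 : 0 ≤ Real.exp l - 1 := by linarith [Real.one_le_exp hl]
  refine (measureReal_mono hsub (measure_ne_top _ _)).trans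
    ((measureReal_biUnion_finset_le _ _).trans ?_)
  refine (Finset.sum_le_card_nsmul _ _ (Real.exp (p * R * (Real.exp l - 1) - l * a))
    fun z _ => (measureReal_pi_bernoulli_le p hp _ hl a).trans ?_).trans ?_
  · gcongr
    exact hC _ _
  · rw [nsmul_eq_mul]
    gcongr

/-- The parameters of the main theorem: `L = log q`, `Q = √q`. -/
theorem exponent_bound {γ ε L Q q p s k : ℝ} (hγ : 0 < γ) (hγ1 : γ ≤ 1 / 20) (hε : 20 * γ ≤ ε)
    (hL : 32 ≤ γ ^ 3 * L) (hQ : 1 ≤ Q) (hq : 2 ≤ γ * q) (hp : 0 ≤ p) (hpq : Q * L ^ 3 ≤ p * q)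
    (hs : s ≤ 2 * Q) (hk : k ≤ 9 * Q * L / γ) :
    2 * s * L + k + 2 * k * L + (p * ((1 + γ) * (q + 1)) * (Real.exp γ - 1) -
      γ * ((1 + ε / 2) * p * q)) ≤ -L := by
  have hL0 : 0 < L := by
    by_contra! h
    nlinarith [pow_pos hγ 3]
  have hL1 : 1 ≤ L := by
    have : γ ^ 3 ≤ 1 := pow_le_one₀ hγ.le (by linarith)
    nlinarith
  have hq0 : 0 < q := by
    by_contra! h
    nlinarith
  have hexp : Real.exp γ - 1 ≤ γ + γ ^ 2 := by
    have := (abs_le.1 (Real.abs_exp_sub_one_sub_id_le (x := γ) (by rw [abs_of_pos hγ]; linarith))).2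
    linarith
  have hE : p * ((1 + γ) * (q + 1)) * (Real.exp γ - 1) - γ * ((1 + ε / 2) * p * q) ≤
      -(γ ^ 2 * (Q * L ^ 3)) := by
    have h1 : (1 + γ) * (q + 1) ≤ (1 + 2 * γ) * q := by nlinarith
    have h2 : p * ((1 + γ) * (q + 1)) * (Real.exp γ - 1) ≤
        p * ((1 + 2 * γ) * q) * (γ + γ ^ 2) := by
      have := Real.one_le_exp hγ.le
      gcongr
    have h3 : γ * ((1 + 10 * γ) * p * q) ≤ γ * ((1 + ε / 2) * p * q) := by
      gcongr
      linarith
    have h4 : γ ^ 2 * (Q * L ^ 3) ≤ γ ^ 2 * (p * q) := by gcongr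
    have h5 : 0 ≤ p * q * γ ^ 2 * (6 - 2 * γ) :=
      mul_nonneg (by positivity) (by linarith)
    linarith [h5]
  have hX : 32 * (Q * L ^ 2 / γ) ≤ γ ^ 2 * (Q * L ^ 3) := by
    calc 32 * (Q * L ^ 2 / γ) ≤ γ ^ 3 * L * (Q * L ^ 2 / γ) := by gcongr
      _ = γ ^ 2 * (Q * L ^ 3) := by field_simp
  have hγ' : 1 ≤ 1 / γ := by rw [le_div_iff₀ hγ]; linarith
  have hQL : L ≤ Q * L ^ 2 := by nlinarith
  have hXL : Q * L ^ 2 ≤ Q * L ^ 2 / γ := by rw [le_div_iff₀ hγ]; nlinarith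
  have hk1 : k ≤ 9 * (Q * L ^ 2 / γ) := by
    calc k ≤ 9 * Q * L / γ := hk
      _ ≤ 9 * Q * (L * L) / γ := by gcongr; nlinarith
      _ = _ := by ring
  have hk2 : 2 * k * L ≤ 18 * (Q * L ^ 2 / γ) := by
    calc 2 * k * L ≤ 2 * (9 * Q * L / γ) * L := by gcongr
      _ = _ := by ring
  have hs1 : 2 * s * L ≤ 4 * (Q * L ^ 2) := by
    calc 2 * s * L ≤ 2 * (2 * Q) * (L * L) := by gcongr; nlinarith
      _ = _ := by ring
  linarith

theorem fingerprint_card_le {γ L Q q s : ℝ} {t : ℕ} (hγ : 0 < γ) (hγ1 : γ ≤ 1) (hL : 1 ≤ L)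
    (hQ : 1 ≤ Q) (hq : Q ^ 2 = q) (hLq : L = Real.log q) (hs : Q ≤ s)
    (h : Real.exp (s * γ / (2 * (1 + γ) * (q + 1)) * (t - 1)) ≤ q) :
    t ≤ 9 * Q * L / γ := by
  have hq1 : 1 ≤ q := by nlinarith
  have hX : 1 ≤ Q * L / γ := by rw [le_div_iff₀ hγ]; nlinarith
  have hX' : 9 * Q * L / γ = 9 * (Q * L / γ) := by ring
  rcases Nat.eq_zero_or_pos t with rfl | ht
  · rw [hX']; push_cast; linarith
  have ht1 : (0 : ℝ) ≤ t - 1 := by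
    have : (1 : ℝ) ≤ t := by exact_mod_cast ht
    linarith
  have hβ : γ / (8 * Q) ≤ s * γ / (2 * (1 + γ) * (q + 1)) := by
    rw [div_le_div_iff₀ (by positivity) (by positivity)]
    have h1 : 2 * (1 + γ) * (q + 1) ≤ 8 * q := by nlinarith
    calc γ * (2 * (1 + γ) * (q + 1)) ≤ γ * (8 * q) := by gcongr
      _ = Q * γ * (8 * Q) := by rw [← hq]; ring
      _ ≤ s * γ * (8 * Q) := by gcongr
  have h2 : γ / (8 * Q) * (t - 1) ≤ L := by
    rw [hLq, Real.le_log_iff_exp_le (by linarith)]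
    refine le_trans ?_ h
    gcongr
  have h3 : (t : ℝ) - 1 ≤ 8 * (Q * L / γ) := by
    calc (t : ℝ) - 1 = γ / (8 * Q) * (t - 1) * (8 * Q / γ) := by field_simp
      _ ≤ L * (8 * Q / γ) := by gcongr
      _ = _ := by ring
  rw [hX']
  linarith

/-- For every `ε > 0` and `δ > 0` there exists `q₀` such that for every
prime power `q ≥ q₀` (i.e. every finite field `F` of cardinality `q`) and every
`p` with `(log q)³/√q ≤ p ≤ 1`, the probability that the `p`-random subset of `F²`
(each point included independently with probability `p`) contains a collinear-triple-free
subset of size at least `(1+ε)·p·q` is at most `δ`. -/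
theorem statement6 (ε δ : ℝ) (hε : 0 < ε) (hδ : 0 < δ) :
    ∃ q0 : ℕ, ∀ q : ℕ, q0 ≤ q → IsPrimePow q →
      ∀ (F : Type) [Field F] [Fintype F], Fintype.card F = q →
        ∀ (p : ℝ≥0) (hp1 : p ≤ 1),
          Real.log q ^ 3 / Real.sqrt q ≤ (p : ℝ) →
          (Measure.pi fun _ : Fin 2 → F => (PMF.bernoulli p (by exact_mod_cast hp1)).toMeasure)
              {ω : (Fin 2 → F) → Bool |
                ∃ T : Finset (Fin 2 → F),
                  (∀ x ∈ T, ω x = true) ∧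
                  (∀ t : Finset (Fin 2 → F), t ⊆ T → t.card = 3 →
                    ¬ Collinear F (t : Set (Fin 2 → F))) ∧
                  (1 + ε) * p * q ≤ (T.card : ℝ)} ≤
            ENNReal.ofReal δ := by
  obtain ⟨γ, hγ, hγ1, hγε⟩ : ∃ γ : ℝ, 0 < γ ∧ γ ≤ 1 / 20 ∧ 20 * γ ≤ ε :=
    ⟨min 1 ε / 20, by positivity, by linarith [min_le_left 1 ε], by linarith [min_le_right 1 ε]⟩
  refine ⟨⌈Real.exp (max (32 / γ ^ 3) (-Real.log δ))⌉₊, ?_⟩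
  intro q hq0 _ F _ _ hFq p hp1 hp
  classical
  have hexpq := Nat.ceil_le.1 hq0
  have hqpos : (0 : ℝ) < q := (Real.exp_pos _).trans_le hexpq
  have hmax := (Real.le_log_iff_exp_le hqpos).2 hexpq
  obtain ⟨L, hLdef⟩ : ∃ L, L = Real.log q := ⟨_, rfl⟩
  obtain ⟨Q, hQdef⟩ : ∃ Q, Q = Real.sqrt q := ⟨_, rfl⟩
  rw [← hLdef] at hmax hp
  rw [← hQdef] at hp
  have hL : 32 ≤ γ ^ 3 * L := by
    rw [← div_le_iff₀' (by positivity)]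
    exact (le_max_left _ _).trans hmax
  have hLδ : -L ≤ Real.log δ := by linarith [(le_max_right (32 / γ ^ 3) _).trans hmax]
  have hL0 : 0 < L := by
    by_contra! h
    nlinarith [pow_pos hγ 3]
  have hγL : 2 ≤ γ * L := by
    have h1 : γ ^ 2 ≤ 1 := pow_le_one₀ hγ.le (by linarith)
    have h2 : γ ^ 2 * (γ * L) ≤ 1 * (γ * L) := by gcongr
    linarith
  have hL1 : 1 ≤ L := by nlinarith
  have hLq : L ≤ q := by
    rw [hLdef]
    linarith [Real.log_le_sub_one_of_pos hqpos]
  have hQ : 1 ≤ Q := by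
    rw [hQdef, Real.one_le_sqrt]
    linarith
  have hQq : Q ^ 2 = q := by rw [hQdef, Real.sq_sqrt hqpos.le]
  have hpq : Q * L ^ 3 ≤ p * q := by
    rw [div_le_iff₀ (by positivity)] at hp
    calc Q * L ^ 3 ≤ Q * (p * Q) := by gcongr
      _ = p * q := by rw [← hQq]; ring
  set s := ⌈Q⌉₊
  set k := ⌊9 * Q * L / γ⌋₊
  have hsQ : Q ≤ s := Nat.le_ceil _
  have hs2 : (s : ℝ) ≤ 2 * Q := by linarith [Nat.ceil_lt_add_one (a := Q) (by linarith)]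
  have hk : (k : ℝ) ≤ 9 * Q * L / γ := Nat.floor_le (by positivity)
  obtain ⟨C, hC, hcont⟩ := exists_arc_container F s hγ
  rw [hFq] at hC hcont
  have hcard : ((Fintype.card (Fin 2 → F) : ℕ) : ℝ) = Real.exp (2 * L) := by
    rw [Fintype.card_fun, Fintype.card_fin, hFq, hLdef, two_mul, Real.exp_add,
      Real.exp_log hqpos]
    push_cast
    ring
  have hslack : 2 * Q + 9 * Q * L / γ ≤ ε / 2 * (p * q) := by
    have h1 : 9 * Q * L / γ ≤ 9 * Q * L * L := by
      rw [div_le_iff₀ hγ]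
      have : 0 ≤ 9 * Q * L * (γ * L - 1) := mul_nonneg (by positivity) (by linarith)
      linarith
    have h2 : 2 * Q ≤ 2 * (Q * L ^ 2) := by
      gcongr
      exact le_mul_of_one_le_right (by linarith) (one_le_pow₀ hL1)
    calc 2 * Q + 9 * Q * L / γ ≤ 10 * 2 * (Q * L ^ 2) := by nlinarith
      _ ≤ 10 * (γ * L) * (Q * L ^ 2) := by gcongr
      _ = 10 * γ * (Q * L ^ 3) := by ring
      _ ≤ ε / 2 * (p * q) := by
        gcongr
        linarith
  have hsub : {ω : (Fin 2 → F) → Bool | ∃ T : Finset (Fin 2 → F), (∀ x ∈ T, ω x = true) ∧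
        (∀ t : Finset (Fin 2 → F), t ⊆ T → t.card = 3 →
          ¬ Collinear F (t : Set (Fin 2 → F))) ∧ (1 + ε) * p * q ≤ (T.card : ℝ)} ⊆
      {ω | ∃ B T : Finset (Fin 2 → F), B.card = s ∧ T.card ≤ k ∧
        (1 + ε / 2) * p * q ≤ (((C B T).filter fun x => ω x = true).card : ℝ)} := by
    rintro ω ⟨A, hAω, hA, hAcard⟩
    have hsA : s ≤ A.card := by
      have h0 : 0 ≤ 9 * Q * L / γ := by positivity
      have h1 : 0 ≤ (1 + ε / 2) * (p * q) := by positivity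
      have : (s : ℝ) ≤ A.card := by linarith
      exact_mod_cast this
    obtain ⟨B, T, hB, hABT, hT⟩ := hcont A hA hsA
    have hTk : T.card ≤ k := by
      rcases hT with rfl | hT
      · simp
      · exact Nat.le_floor
          (fingerprint_card_le hγ (by linarith) hL1 hQ hQq hLdef hsQ hT)
    refine ⟨B, T, hB, hTk, ?_⟩
    have hle : A.card ≤ s + T.card + ((C B T).filter fun x => ω x = true).card := by
      rw [← hB]
      refine (Finset.card_le_card fun x hx => ?_).trans ((Finset.card_union_le (B ∪ T) _).trans
        (Nat.add_le_add_right (Finset.card_union_le B T) _))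
      have := hABT hx
      simp only [Finset.mem_union, Finset.mem_filter] at this ⊢
      exact this.imp_right fun h => ⟨h, hAω x hx⟩
    have hle' : (A.card : ℝ) ≤ s + T.card + ((C B T).filter fun x => ω x = true).card := by
      exact_mod_cast hle
    have hTk' : (T.card : ℝ) ≤ k := by exact_mod_cast hTk
    linarith
  refine (ENNReal.le_ofReal_iff_toReal_le (measure_ne_top _ _) hδ.le).2 ?_
  refine (measureReal_mono hsub (measure_ne_top _ _)).trans
    ((measureReal_pi_bernoulli_exists_le p hp1 C s k hC hγ.le).trans ?_)
  calc _ ≤ Real.exp (2 * L) ^ s * (Real.exp k * Real.exp (2 * L) ^ k) *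
        Real.exp (p * ((1 + γ) * (q + 1)) * (Real.exp γ - 1) -
          γ * ((1 + ε / 2) * p * q)) := by
        rw [hcard]
        gcongr
        exact Real.add_one_le_exp _
    _ = Real.exp (2 * s * L + k + 2 * k * L + (p * ((1 + γ) * (q + 1)) * (Real.exp γ - 1) -
          γ * ((1 + ε / 2) * p * q))) := by
        rw [← Real.exp_nat_mul, ← Real.exp_nat_mul, ← Real.exp_add, ← Real.exp_add,
          ← Real.exp_add]
        ring_nf
    _ ≤ Real.exp (Real.log δ) := by
        gcongr
        exact (exponent_bound hγ hγ1 hγε hL hQ (by nlinarith) p.coe_nonneg hpq hs2 hk).trans hLδ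
    _ = δ := Real.exp_log hδ
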